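/- Let Γ be a countable weakly branch group acting on the boundary X of the spherically symmetric rooted tree with valency sequence d, and let μ be an ergodic invariant random subgroup of Γ. Then there exists a sequence of positive integers (m_ℓ)_{ℓ∈ℕ} such that for μ-almost every subgroup H ≤ Γ the following holds: for every finite word x, say of length ℓ, such that C_x ∩ Fix(H) = ∅ and such that either ℓ = 0 or the cylinder of the length-(ℓ−1) prefix of x meets Fix(H), one has [Rist^Γ_{m_ℓ}(T_x), Rist^Γ_{m_ℓ}(T_x)] ≤ H. -/

import Mathlib

open MulOpposite MeasureTheory

/-- The σ-algebra on the space of subgroups of `G`, generated by the sets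
`{H : g ∈ H}` for `g ∈ G` (the Borel σ-algebra of the Chabauty topology). -/
instance subgroupMeasurableSpace (G : Type*) [Group G] : MeasurableSpace (Subgroup G) :=
  MeasurableSpace.generateFrom {A : Set (Subgroup G) | ∃ g : G, A = {H : Subgroup G | g ∈ H}}

/-- Conjugation `H ↦ g⁻¹ H g` on subgroups. -/
def conjSubgroup {G : Type*} [Group G] (g : G) (H : Subgroup G) : Subgroup G :=
  Subgroup.map (MulAut.conj g⁻¹).toMonoidHom H

/-- Pointwise stabilizer of a set `A ⊆ X` for a right action of `G` on `X`:
`{g ∈ G : x·g = x for all x ∈ A}`. -/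
def pointwiseStabilizer (G : Type*) {X : Type*} [Group G] [MulAction Gᵐᵒᵖ X] (A : Set X) :
    Subgroup G where
  carrier := {g : G | ∀ x ∈ A, op g • x = x}
  one_mem' := by intro x _; simp
  mul_mem' := by
    intro g h hg hh x hx
    have h1 : op (g * h) • x = op h • (op g • x) := by
      rw [op_mul, mul_smul]
    rw [h1, hg x hx, hh x hx]
  inv_mem' := by
    intro g hg x hx
    have h1 : op g⁻¹ • (op g • x) = x := by
      rw [op_inv]; exact inv_smul_smul _ _
    rw [hg x hx] at h1
    exact h1

/-- Rigid stabilizer `R_G(U) = {g ∈ G : x·g = x for all x ∈ X \ U}`. -/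
def rigidStabilizer (G : Type*) {X : Type*} [Group G] [MulAction Gᵐᵒᵖ X] (U : Set X) :
    Subgroup G :=
  pointwiseStabilizer G Uᶜ

/-- The fixed-point set of a subgroup `H` in `X`: `Fix(H) = {x : x·h = x for all h ∈ H}`. -/
def fixedSet (X : Type*) {G : Type*} [Group G] [MulAction Gᵐᵒᵖ X] (H : Subgroup G) : Set X :=
  {x : X | ∀ h ∈ H, op h • x = x}

/-- The cylinder in `∏ i, Fin (d i)` of the length-`ℓ` prefix of `z`:
`{x : x i = z i for all i < ℓ}`.  Since every finite word of length `ℓ` extends to a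
boundary point, cylinders of length-`ℓ` words are exactly the sets of this form. -/
def cylinder (d : ℕ → ℕ) (ℓ : ℕ) (z : ∀ i, Fin (d i)) : Set (∀ i, Fin (d i)) :=
  {x | ∀ i < ℓ, x i = z i}

/-- `Γ` acts by tree automorphisms: every element maps every cylinder of a length-`ℓ`
word onto a cylinder of a length-`ℓ` word. -/
def ActsByTreeAutomorphisms (G : Type*) (d : ℕ → ℕ) [Group G]
    [MulAction Gᵐᵒᵖ (∀ i, Fin (d i))] : Prop :=
  ∀ g : G, ∀ ℓ : ℕ, ∀ z : ∀ i, Fin (d i), ∃ z' : ∀ i, Fin (d i),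
    (fun x : ∀ i, Fin (d i) => op g • x) '' cylinder d ℓ z = cylinder d ℓ z'

/-- The action of `Γ` is level transitive: for each `ℓ` the induced action on cylinders
of length-`ℓ` words is transitive. -/
def LevelTransitive (G : Type*) (d : ℕ → ℕ) [Group G]
    [MulAction Gᵐᵒᵖ (∀ i, Fin (d i))] : Prop :=
  ∀ ℓ : ℕ, ∀ z z' : ∀ i, Fin (d i), ∃ g : G,
    (fun x : ∀ i, Fin (d i) => op g • x) '' cylinder d ℓ z = cylinder d ℓ z'

/-- The level-`m` rigid stabilizer `Rist_m^Γ(T_x)` of the subtree rooted at the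
length-`ℓ` word represented by `z`: the subgroup generated by the rigid stabilizers of
the cylinders of all words of length `ℓ + m` extending it. -/
def ristLevel (G : Type*) (d : ℕ → ℕ) [Group G] [MulAction Gᵐᵒᵖ (∀ i, Fin (d i))]
    (ℓ m : ℕ) (z : ∀ i, Fin (d i)) : Subgroup G :=
  ⨆ z' ∈ cylinder d ℓ z, rigidStabilizer G (cylinder d (ℓ + m) z')


/-! ### Measure theory on the space of subgroups -/

theorem measurableSet_memSub {G : Type*} [Group G] (g : G) :
    MeasurableSet {H : Subgroup G | g ∈ H} :=
  MeasurableSpace.measurableSet_generateFrom ⟨g, rfl⟩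

theorem mem_conjSubgroup {G : Type*} [Group G] (k x : G) (H : Subgroup G) :
    x ∈ conjSubgroup k H ↔ k * x * k⁻¹ ∈ H := by
  unfold conjSubgroup
  rw [Subgroup.mem_map]
  constructor
  · rintro ⟨y, hy, rfl⟩
    simpa [mul_assoc] using hy
  · intro h
    exact ⟨_, h, by simp [mul_assoc]⟩

theorem conjSubgroup_conjSubgroup {G : Type*} [Group G] (k l : G) (H : Subgroup G) :
    conjSubgroup k (conjSubgroup l H) = conjSubgroup (l * k) H := by
  ext x
  simp [mem_conjSubgroup, mul_assoc]

theorem conjSubgroup_one {G : Type*} [Group G] (H : Subgroup G) :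
    conjSubgroup 1 H = H := by
  ext x
  simp [mem_conjSubgroup]

theorem measurable_conjSubgroup {G : Type*} [Group G] (k : G) :
    Measurable (fun H : Subgroup G => conjSubgroup k H) := by
  refine measurable_generateFrom ?_
  rintro _ ⟨g, rfl⟩
  have : (fun H : Subgroup G => conjSubgroup k H) ⁻¹' {H | g ∈ H}
      = {H : Subgroup G | k * g * k⁻¹ ∈ H} := by
    ext H; simp [mem_conjSubgroup]
  rw [this]
  exact measurableSet_memSub _

open Classical in
/-- Indicator function of a subgroup. -/
noncomputable def subInd {G : Type*} [Group G] (H : Subgroup G) : G → Bool := fun g => decide (g ∈ H)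

theorem subInd_injective {G : Type*} [Group G] : Function.Injective (subInd (G := G)) := by
  intro H K h
  ext g
  have := congrFun h g
  simpa [subInd] using this

theorem isClosed_range_subInd {G : Type*} [Group G] :
    IsClosed (Set.range (subInd (G := G))) := by
  have : Set.range (subInd (G := G)) =
      {f | f 1 = true} ∩ (⋂ a : G, ⋂ b : G, {f | f a = true → f b = true → f (a * b) = true}) ∩
        (⋂ a : G, {f | f a = true → f a⁻¹ = true}) := by
    ext f
    constructor
    · rintro ⟨H, rfl⟩
      simp only [subInd, Set.mem_inter_iff, Set.mem_ofPred_eq, Set.mem_iInter, decide_eq_true_eq]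
      exact ⟨⟨H.one_mem, fun a b => H.mul_mem⟩, fun a => H.inv_mem⟩
    · simp only [Set.mem_inter_iff, Set.mem_ofPred_eq, Set.mem_iInter]
      rintro ⟨⟨h1, h2⟩, h3⟩
      refine ⟨{ carrier := {g | f g = true}, one_mem' := h1, mul_mem' := fun {a b} => h2 a b,
                inv_mem' := fun {a} => h3 a }, ?_⟩
      ext g
      simp [subInd, ← SetLike.mem_coe]
  rw [this]
  have key : ∀ (s : Set (G → Bool)) (F : Finset G) (P : (F → Bool) → Prop),
      s = {f | P (fun i => f i)} → IsClosed s := by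
    intro s F P hs
    have hc : Continuous (fun f : G → Bool => (fun i : F => f i)) := by fun_prop
    have : s = (fun f : G → Bool => (fun i : F => f i)) ⁻¹' {y | P y} := hs
    rw [this]
    exact (isClosed_discrete _).preimage hc
  classical
  refine ((?_ : IsClosed _).inter (isClosed_iInter fun a => isClosed_iInter fun b => ?_)).inter
    (isClosed_iInter fun a => ?_)
  · exact key _ {1} (fun y => y ⟨1, by simp⟩ = true) rfl
  · exact key _ {a, b, a * b} (fun y => y ⟨a, by simp⟩ = true → y ⟨b, by simp⟩ = true →
      y ⟨a * b, by simp⟩ = true) rfl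
  · exact key _ {a, a⁻¹} (fun y => y ⟨a, by simp⟩ = true → y ⟨a⁻¹, by simp⟩ = true) rfl

theorem subgroup_measurableSpace_eq {G : Type*} [Group G] :
    subgroupMeasurableSpace G = MeasurableSpace.comap (subInd (G := G)) MeasurableSpace.pi := by
  apply le_antisymm
  · refine MeasurableSpace.generateFrom_le ?_
    rintro _ ⟨g, rfl⟩
    refine ⟨{f | f g = true}, ?_, ?_⟩
    · exact (measurable_pi_apply (X := fun _ : G => Bool) g) (measurableSet_singleton true)
    · ext H; simp [subInd]
  · rw [← measurable_iff_comap_le]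
    refine measurable_pi_lambda _ fun g => ?_
    refine measurable_to_bool ?_
    have : (fun H : Subgroup G => subInd H g) ⁻¹' {true} = {H | g ∈ H} := by
      ext H; simp [subInd]
    rw [this]
    exact measurableSet_memSub g

theorem standardBorel_subgroup (G : Type*) [Group G] [Countable G] :
    StandardBorelSpace (Subgroup G) := by
  let τ : TopologicalSpace (Subgroup G) := TopologicalSpace.induced subInd inferInstance
  have hemb : Topology.IsClosedEmbedding (subInd (G := G)) :=
    ⟨⟨⟨rfl⟩, subInd_injective⟩, isClosed_range_subInd⟩
  have i1 : TopologicalSpace.IsCompletelyMetrizableSpace (G → Bool) := inferInstance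
  have i2 : TopologicalSpace.SeparableSpace (G → Bool) := inferInstance
  have i3 : PolishSpace (G → Bool) := inferInstance
  refine ⟨τ, ⟨?_⟩, hemb.polishSpace⟩
  rw [subgroup_measurableSpace_eq]
  have : (MeasurableSpace.pi : MeasurableSpace (G → Bool)) = borel (G → Bool) :=
    BorelSpace.measurable_eq
  rw [this]
  exact borel_comap.symm

/-- Sets invariant under conjugation by `K`. -/
def invSigma {G : Type*} [Group G] (K : Subgroup G) : MeasurableSpace (Subgroup G) where
  MeasurableSet' s := MeasurableSet s ∧ ∀ k ∈ K, (fun H : Subgroup G => conjSubgroup k H) ⁻¹' s = s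
  measurableSet_empty := ⟨MeasurableSet.empty, fun _ _ => rfl⟩
  measurableSet_compl s hs := ⟨hs.1.compl, fun k hk => by rw [Set.preimage_compl, hs.2 k hk]⟩
  measurableSet_iUnion f hf := ⟨MeasurableSet.iUnion fun i => (hf i).1, fun k hk => by
    rw [Set.preimage_iUnion]; exact Set.iUnion_congr fun i => (hf i).2 k hk⟩

theorem invSigma_le {G : Type*} [Group G] (K : Subgroup G) :
    invSigma K ≤ subgroupMeasurableSpace G := fun _ hs => hs.1

/-- Ergodic-decomposition style statement. -/
theorem exists_local_measure {G : Type*} [Group G] [Countable G]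
    (μ : Measure (Subgroup G)) [IsProbabilityMeasure μ]
    (hinv : ∀ g : G, ∀ A : Set (Subgroup G), MeasurableSet A →
      μ ((fun H : Subgroup G => conjSubgroup g H) ⁻¹' A) = μ A)
    (K : Subgroup G) {ι : Type*} [Countable ι] (B : ι → Set (Subgroup G))
    (hB : ∀ i, MeasurableSet (B i)) :
    ∀ᵐ H ∂μ, ∃ ν : Measure (Subgroup G), IsProbabilityMeasure ν ∧
      (∀ i, ∀ k ∈ K, ν ((fun H : Subgroup G => conjSubgroup k H) ⁻¹' B i) = ν (B i)) ∧
      (∀ i, ν (B i) ≠ 0 → ∃ k ∈ K, conjSubgroup k H ∈ B i) ∧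
      (∀ i, H ∈ B i → ν (B i) ≠ 0) := by
  have := standardBorel_subgroup G
  have hle : invSigma K ≤ subgroupMeasurableSpace G := invSigma_le K
  set κ := ProbabilityTheory.condExpKernel μ (invSigma K) with hκ
  have hce : ∀ s : Set (Subgroup G), MeasurableSet s →
      (fun ω => (κ ω).real s) =ᵐ[μ] μ[s.indicator (fun _ => (1 : ℝ)) | invSigma K] := fun s hs =>
    ProbabilityTheory.condExpKernel_ae_eq_condExp hle hs
  have hintegr : ∀ s : Set (Subgroup G), MeasurableSet s →
      Integrable (s.indicator (fun _ => (1 : ℝ))) μ := fun s hs =>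
    (integrable_const _).indicator hs
  have h1 : ∀ i, ∀ k : K, ∀ᵐ H ∂μ,
      κ H ((fun H : Subgroup G => conjSubgroup (k : G) H) ⁻¹' B i) = κ H (B i) := by
    intro i k
    have hmk := measurable_conjSubgroup (k : G) (hB i)
    have : μ[((fun H : Subgroup G => conjSubgroup (k : G) H) ⁻¹' B i).indicator
        (fun _ => (1 : ℝ)) | invSigma K] =ᵐ[μ] μ[(B i).indicator (fun _ => (1 : ℝ)) | invSigma K] := by
      refine ae_eq_condExp_of_forall_setIntegral_eq hle (hintegr _ (hB i))
        (fun s _ _ => integrable_condExp.integrableOn) ?_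
        stronglyMeasurable_condExp.aestronglyMeasurable
      intro s hs _
      rw [setIntegral_condExp hle (hintegr _ hmk) hs, integral_indicator hmk, integral_indicator (hB i)]
      simp only [integral_const, smul_eq_mul, mul_one, Measure.real, Measure.restrict_restrict,
        hmk, hB i, Measure.restrict_apply, MeasurableSet.univ, Set.univ_inter]
      congr 1
      rw [← hinv (k : G) (B i ∩ s) ((hB i).inter hs.1), Set.preimage_inter, hs.2 k k.2]
    filter_upwards [hce _ hmk, hce _ (hB i), this] with H a b c
    have : (κ H).real ((fun H : Subgroup G => conjSubgroup (k : G) H) ⁻¹' B i)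
      = (κ H).real (B i) := by rw [a, b, c]
    exact (measureReal_eq_measureReal_iff).1 this
  have h2 : ∀ i, ∀ᵐ H ∂μ, κ H (B i) ≠ 0 → ∃ k ∈ K, conjSubgroup k H ∈ B i := by
    intro i
    set Y : Set (Subgroup G) := ⋃ k : K, (fun H : Subgroup G => conjSubgroup (k : G) H) ⁻¹' B i
    have hY : MeasurableSet[invSigma K] Y := by
      refine ⟨MeasurableSet.iUnion fun k => measurable_conjSubgroup (k : G) (hB i), ?_⟩
      intro k hk
      ext H
      simp only [Y, Set.mem_preimage, Set.mem_iUnion, conjSubgroup_conjSubgroup]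
      constructor
      · rintro ⟨l, hl⟩
        exact ⟨⟨k * l, K.mul_mem hk l.2⟩, hl⟩
      · rintro ⟨l, hl⟩
        exact ⟨⟨k⁻¹ * l, K.mul_mem (K.inv_mem hk) l.2⟩, by simpa using hl⟩
    have hc : μ[Y.indicator (fun _ => (1 : ℝ)) | invSigma K] = Y.indicator (fun _ => (1 : ℝ)) :=
      condExp_of_stronglyMeasurable hle (stronglyMeasurable_const.indicator hY) (hintegr _ hY.1)
    filter_upwards [hce Y hY.1] with H h hne
    rw [hc] at h
    by_contra hcon
    have hHY : H ∉ Y := by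
      intro hH
      simp only [Y, Set.mem_iUnion] at hH
      obtain ⟨k, hk⟩ := hH
      exact hcon ⟨k, k.2, hk⟩
    rw [Set.indicator_of_notMem hHY] at h
    have h0 : κ H Y = 0 := (measureReal_eq_zero_iff).1 h
    refine hne (measure_mono_null ?_ h0)
    intro H' hH'
    simp only [Y, Set.mem_iUnion]
    exact ⟨1, by simpa [conjSubgroup_one] using hH'⟩
  have h3 : ∀ i, ∀ᵐ H ∂μ, H ∈ B i → κ H (B i) ≠ 0 := by
    intro i
    set Z : Set (Subgroup G) := {H | κ H (B i) = 0}
    have hZ : MeasurableSet[invSigma K] Z :=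
      (ProbabilityTheory.measurable_condExpKernel (hB i)) (measurableSet_singleton 0)
    have e1 : ∫ x in Z, (B i).indicator (fun _ => (1 : ℝ)) x ∂μ = 0 := by
      rw [← setIntegral_condExp hle (hintegr _ (hB i)) hZ]
      rw [setIntegral_congr_ae (g := fun _ => (0 : ℝ)) (hle _ hZ)]
      · simp
      · filter_upwards [hce _ (hB i)] with H h hH
        rw [← h]
        exact (measureReal_eq_zero_iff).2 hH
    rw [integral_indicator (hB i)] at e1
    simp only [integral_const, smul_eq_mul, mul_one, Measure.real, Measure.restrict_restrict,
        hB i, Measure.restrict_apply, MeasurableSet.univ, Set.univ_inter] at e1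
    have e2 : μ (B i ∩ Z) = 0 := by
      rcases (ENNReal.toReal_eq_zero_iff _).1 e1 with h | h
      · exact h
      · exact absurd h (measure_ne_top _ _)
    have : ∀ᵐ H ∂μ, H ∉ B i ∩ Z := measure_eq_zero_iff_ae_notMem.1 e2
    filter_upwards [this] with H hH hHB h0
    exact hH ⟨hHB, h0⟩
  filter_upwards [ae_all_iff.2 fun i => ae_all_iff.2 (h1 i), ae_all_iff.2 h2, ae_all_iff.2 h3]
    with H a b c
  exact ⟨κ H, inferInstance, fun i k hk => a i ⟨k, hk⟩, b, c⟩

theorem pigeon (p : ENNReal) (hp : p ≠ 0) :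
    ∃ (m : ℕ) (ε : ENNReal), ε ≠ 0 ∧ ∀ (Ω : Type _) (_ : MeasurableSpace Ω) (ν : Measure Ω),
      IsProbabilityMeasure ν → ∀ E : Fin m → Set Ω, (∀ i, MeasurableSet (E i)) →
      (∀ i, p ≤ ν (E i)) → ∃ i j, i ≠ j ∧ ε ≤ ν (E i ∩ E j) := by
  have hq : min p 1 ≠ 0 := by simp [hp]
  have hqt : min p 1 ≠ ⊤ := ne_of_lt (lt_of_le_of_lt (min_le_right _ _) ENNReal.one_lt_top)
  set q := min p 1 with hqdef
  obtain ⟨m, hm⟩ := ENNReal.exists_nat_mul_gt (a := q / 2) (b := 1)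
    (by simp [hq]) (by simp)
  have hm0 : (m : ENNReal) ≠ 0 := by
    rintro h; rw [h] at hm; simp at hm
  refine ⟨m, q / 2 / m, ?_, ?_⟩
  · simp [hq]
  intro Ω _ ν hν E hE hpE
  by_contra hcon
  push Not at hcon
  set E' : Fin m → Set Ω := fun i => E i \ ⋃ j ∈ Finset.univ.erase i, (E i ∩ E j) with hE'
  have hE'm : ∀ i, MeasurableSet (E' i) := fun i =>
    (hE i).diff (Finset.measurableSet_biUnion _ fun j _ => (hE i).inter (hE j))
  have hlow : ∀ i, q / 2 ≤ ν (E' i) := by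
    intro i
    have hb : ν (⋃ j ∈ Finset.univ.erase i, (E i ∩ E j)) ≤ q / 2 := by
      refine (measure_biUnion_finset_le _ _).trans ?_
      refine (Finset.sum_le_card_nsmul _ _ (q / 2 / m) ?_).trans ?_
      · intro j hj
        exact (hcon i j (Finset.ne_of_mem_erase hj).symm).le
      · rw [nsmul_eq_mul]
        calc _ ≤ (m : ENNReal) * (q / 2 / m) := by
              gcongr
              simp
          _ = q / 2 := ENNReal.mul_div_cancel hm0 (by simp)
    calc q / 2 = q - q / 2 := (ENNReal.sub_half hqt).symm
      _ ≤ ν (E i) - ν (⋃ j ∈ Finset.univ.erase i, (E i ∩ E j)) :=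
        tsub_le_tsub ((min_le_left _ _).trans (hpE i)) hb
      _ ≤ ν (E' i) := le_measure_sdiff
  obtain ⟨i, -, j, -, hij, x, hx⟩ := exists_nonempty_inter_of_measure_univ_lt_sum_measure ν
    (s := Finset.univ) (t := E') (fun i _ => (hE'm i).nullMeasurableSet) (by
      rw [measure_univ]
      calc (1 : ENNReal) < m * (q / 2) := hm
        _ = ∑ i : Fin m, q / 2 := by simp
        _ ≤ _ := Finset.sum_le_sum fun i _ => hlow i)
  refine hx.1.2 ?_
  simp only [Set.mem_iUnion]
  exact ⟨j, by simp [hij.symm], hx.1.1, hx.2.1⟩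

/-! ### Geometry of the action -/

section geometry

variable {G : Type*} [Group G] {d : ℕ → ℕ} [MulAction Gᵐᵒᵖ (∀ i, Fin (d i))]

theorem act_mul (g h : G) (x : ∀ i, Fin (d i)) : op (g * h) • x = op h • (op g • x) := by
  rw [op_mul, mul_smul]

theorem act_inv_act (g : G) (x : ∀ i, Fin (d i)) : op g⁻¹ • (op g • x) = x := by
  rw [op_inv]; exact inv_smul_smul _ _

theorem act_act_inv (g : G) (x : ∀ i, Fin (d i)) : op g • (op g⁻¹ • x) = x := by
  rw [op_inv]; exact smul_inv_smul _ _

theorem act_one (x : ∀ i, Fin (d i)) : op (1 : G) • x = x := by simp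

theorem act_inj (g : G) {x y : ∀ i, Fin (d i)} (h : op g • x = op g • y) : x = y := by
  have := congrArg (fun z => op g⁻¹ • z) h
  simpa only [act_inv_act] using this

theorem mem_rist {U : Set (∀ i, Fin (d i))} {a : G} :
    a ∈ rigidStabilizer G U ↔ ∀ x, x ∉ U → op a • x = x := Iff.rfl

theorem rist_mono {U V : Set (∀ i, Fin (d i))} (h : U ⊆ V) :
    rigidStabilizer G U ≤ rigidStabilizer G V := fun _ ha x hx =>
  ha x fun hxU => hx (h hxU)

theorem rist_maps {U : Set (∀ i, Fin (d i))} {a : G} (ha : a ∈ rigidStabilizer G U)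
    {x : ∀ i, Fin (d i)} (hx : x ∈ U) : op a • x ∈ U := by
  by_contra h
  have := mem_rist.1 ha _ h
  exact h ((act_inj a this).symm ▸ hx)

theorem rist_comm (hfaith : ∀ g : G, (∀ x : ∀ i, Fin (d i), op g • x = x) → g = 1)
    {U V : Set (∀ i, Fin (d i))} (h : Disjoint U V) {a b : G} (ha : a ∈ rigidStabilizer G U)
    (hb : b ∈ rigidStabilizer G V) : a * b = b * a := by
  have hab : ∀ x : ∀ i, Fin (d i), op (a * b) • x = op (b * a) • x := by
    intro x
    rw [act_mul, act_mul]
    by_cases hx : x ∈ U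
    · rw [mem_rist.1 hb x (Set.disjoint_left.1 h hx),
        mem_rist.1 hb _ (Set.disjoint_left.1 h (rist_maps ha hx))]
    · rw [mem_rist.1 ha x hx]
      by_cases hx' : x ∈ V
      · rw [mem_rist.1 ha _ (Set.disjoint_right.1 h (rist_maps hb hx'))]
      · rw [mem_rist.1 hb _ hx', mem_rist.1 ha _ hx]
  have : a * b * (b * a)⁻¹ = 1 := by
    apply hfaith
    intro x
    rw [act_mul, hab, ← act_mul, mul_inv_cancel, act_one]
  exact mul_inv_eq_one.1 this

theorem rist_conj {U V : Set (∀ i, Fin (d i))} {g a : G}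
    (h : (fun x : ∀ i, Fin (d i) => op g • x) '' U = V)
    (ha : a ∈ rigidStabilizer G U) : g⁻¹ * a * g ∈ rigidStabilizer G V := by
  rw [mem_rist]
  intro x hx
  rw [act_mul, act_mul, mem_rist.1 ha, act_act_inv]
  intro hU
  apply hx
  rw [← h]
  exact ⟨_, hU, act_act_inv g x⟩

theorem mem_cyl_self (n : ℕ) (z : ∀ i, Fin (d i)) : z ∈ cylinder d n z := fun _ _ => rfl

theorem cyl_eq_of_mem {n : ℕ} {z x : ∀ i, Fin (d i)} (h : x ∈ cylinder d n z) :
    cylinder d n x = cylinder d n z := by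
  ext y
  constructor
  · intro hy i hi
    rw [hy i hi, h i hi]
  · intro hy i hi
    rw [hy i hi, h i hi]

theorem cyl_anti {n m : ℕ} (h : n ≤ m) (z : ∀ i, Fin (d i)) : cylinder d m z ⊆ cylinder d n z :=
  fun _ hx i hi => hx i (hi.trans_le h)

theorem cyl_disjoint {n : ℕ} {z w : ∀ i, Fin (d i)} (h : cylinder d n z ≠ cylinder d n w) :
    Disjoint (cylinder d n z) (cylinder d n w) := by
  rw [Set.disjoint_left]
  intro x hx hw
  exact h ((cyl_eq_of_mem hx).symm.trans (cyl_eq_of_mem hw))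

theorem cyl_image (htree : ActsByTreeAutomorphisms G d) (g : G) (n : ℕ) (z : ∀ i, Fin (d i)) :
    (fun x : ∀ i, Fin (d i) => op g • x) '' cylinder d n z = cylinder d n (op g • z) := by
  obtain ⟨z', hz'⟩ := htree g n z
  rw [hz']
  refine (cyl_eq_of_mem ?_).symm
  rw [← hz']
  exact ⟨z, mem_cyl_self n z, rfl⟩

/-- distinct points are separated from some level on -/
theorem cyl_separate {x y : ∀ i, Fin (d i)} (h : x ≠ y) :
    ∃ N, ∀ n ≥ N, Disjoint (cylinder d n x) (cylinder d n y) := by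
  obtain ⟨i, hi⟩ := Function.ne_iff.1 h
  refine ⟨i + 1, fun n hn => ?_⟩
  rw [Set.disjoint_left]
  intro w hw hw'
  exact hi ((hw i (by omega)).symm.trans (hw' i (by omega)))

theorem rist_moves (hfaith : ∀ g : G, (∀ x : ∀ i, Fin (d i), op g • x = x) → g = 1)
    (htree : ActsByTreeAutomorphisms G d) (htrans : LevelTransitive G d)
    (hwb : ∀ (ℓ : ℕ) (z : ∀ i, Fin (d i)), rigidStabilizer G (cylinder d ℓ z) ≠ ⊥)
    (n : ℕ) (x : ∀ i, Fin (d i)) :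
    ∃ a ∈ rigidStabilizer G (cylinder d n x), op a • x ≠ x := by
  obtain ⟨⟨h, hh⟩, hne'⟩ := Subgroup.ne_bot_iff_exists_ne_one.1 (hwb n x)
  have hne : h ≠ 1 := fun e => hne' (Subtype.ext e)
  have : ∃ y : ∀ i, Fin (d i), op h • y ≠ y := by
    by_contra hc
    push Not at hc
    exact hne (hfaith h hc)
  obtain ⟨y, hy⟩ := this
  have hyU : y ∈ cylinder d n x := by
    by_contra hc
    exact hy (mem_rist.1 hh y hc)
  obtain ⟨N, hN⟩ := cyl_separate hy
  set k := max N n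
  obtain ⟨g, hg⟩ := htrans k x y
  have hxg : op g • x ∈ cylinder d k y := by
    rw [← hg]; exact ⟨x, mem_cyl_self _ _, rfl⟩
  have himg : (fun x : ∀ i, Fin (d i) => op g⁻¹ • x) '' cylinder d n x = cylinder d n x := by
    have h1 : cylinder d n (op g • x) = cylinder d n x := by
      have h2 : op g • x ∈ cylinder d n y := cyl_anti (le_max_right _ _) y hxg
      rw [cyl_eq_of_mem h2, cyl_eq_of_mem hyU]
    conv_lhs => rw [← h1]
    rw [cyl_image htree, act_inv_act]
  refine ⟨g * h * g⁻¹, by simpa using rist_conj himg hh, ?_⟩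
  intro hfix
  rw [act_mul, act_mul] at hfix
  have h3 : op h • (op g • x) = op g • x := by
    have := congrArg (fun z => op g • z) hfix
    simpa only [act_act_inv] using this
  have h4 : op h • (op g • x) ∈ cylinder d k (op h • y) := by
    rw [← cyl_image htree]
    exact ⟨_, hxg, rfl⟩
  rw [h3] at h4
  exact Set.disjoint_left.1 (hN k (le_max_left _ _)) h4 hxg

theorem rist_orbit_infinite
    (hfaith : ∀ g : G, (∀ x : ∀ i, Fin (d i), op g • x = x) → g = 1)
    (htree : ActsByTreeAutomorphisms G d) (htrans : LevelTransitive G d)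
    (hwb : ∀ (ℓ : ℕ) (z : ∀ i, Fin (d i)), rigidStabilizer G (cylinder d ℓ z) ≠ ⊥)
    (n : ℕ) (x : ∀ i, Fin (d i)) :
    {y | ∃ a ∈ rigidStabilizer G (cylinder d n x), op a • x = y}.Infinite := by
  intro hfin
  set O := {y | ∃ a ∈ rigidStabilizer G (cylinder d n x), op a • x = y} with hO
  have : ∃ N, ∀ y ∈ O, y ≠ x → ∀ k ≥ N, Disjoint (cylinder d k y) (cylinder d k x) := by
    have h1 : ∀ y : ∀ i, Fin (d i), ∃ N, y ≠ x →
        ∀ k ≥ N, Disjoint (cylinder d k y) (cylinder d k x) := by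
      intro y
      by_cases hy : y = x
      · exact ⟨0, fun h => absurd hy h⟩
      · obtain ⟨N, hN⟩ := cyl_separate hy
        exact ⟨N, fun _ => hN⟩
    choose f hf using h1
    refine ⟨hfin.toFinset.sup f, fun y hy hne k hk => hf y hne k (le_trans ?_ hk)⟩
    exact Finset.le_sup (f := f) (hfin.mem_toFinset.2 hy)
  obtain ⟨N, hN⟩ := this
  obtain ⟨a, ha, hax⟩ := rist_moves hfaith htree htrans hwb (max N n) x
  have haO : op a • x ∈ O := ⟨a, rist_mono (cyl_anti (le_max_right _ _) x) ha, rfl⟩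
  exact Set.disjoint_left.1 (hN _ haO hax _ (le_max_left _ _)) (mem_cyl_self _ _)
    (rist_maps ha (mem_cyl_self _ _))

/-- Finite index subgroups of rigid stabilizers have many disjoint translates of small cylinders. -/
theorem many_translates
    (hfaith : ∀ g : G, (∀ x : ∀ i, Fin (d i), op g • x = x) → g = 1)
    (htree : ActsByTreeAutomorphisms G d) (htrans : LevelTransitive G d)
    (hwb : ∀ (ℓ : ℕ) (z : ∀ i, Fin (d i)), rigidStabilizer G (cylinder d ℓ z) ≠ ⊥)
    (n : ℕ) (x : ∀ i, Fin (d i)) (L : Subgroup G)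
    (hL : L.relIndex (rigidStabilizer G (cylinder d n x)) ≠ 0) (m : ℕ) :
    ∃ (σ : Fin m → G) (k : ℕ), n ≤ k ∧ (∀ i, σ i ∈ L) ∧
      (∀ i, σ i ∈ rigidStabilizer G (cylinder d n x)) ∧
      ∀ i j, i ≠ j → Disjoint (cylinder d k (op (σ i) • x)) (cylinder d k (op (σ j) • x)) := by
  set K := rigidStabilizer G (cylinder d n x) with hK
  have hinf := rist_orbit_infinite hfaith htree htrans hwb n x
  have hfi : (L.subgroupOf K).FiniteIndex := ⟨hL⟩
  -- the orbit under L ⊓ K is infinite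
  have hinfL : {y | ∃ a ∈ K, a ∈ L ∧ op a • x = y}.Infinite := by
    intro hfin
    apply hinf
    have hq : Finite (K ⧸ L.subgroupOf K) := inferInstance
    have hsub : {y | ∃ a ∈ K, op a • x = y} ⊆
        ⋃ q : K ⧸ L.subgroupOf K,
          (fun y : ∀ i, Fin (d i) => op ((Quotient.out q : K) : G)⁻¹ • y) ''
            {y | ∃ a ∈ K, a ∈ L ∧ op a • x = y} := by
      rintro _ ⟨a, ha, rfl⟩
      let b : K := ⟨a, ha⟩
      refine Set.mem_iUnion.2 ⟨(QuotientGroup.mk b⁻¹ : K ⧸ L.subgroupOf K), ?_⟩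
      obtain ⟨l, hl⟩ := QuotientGroup.mk_out_eq_mul (L.subgroupOf K) b⁻¹
      set o : K := Quotient.out (QuotientGroup.mk b⁻¹ : K ⧸ L.subgroupOf K) with ho
      have hoe : (o : G) = a⁻¹ * ((l : K) : G) := by
        have := congrArg (Subtype.val) hl
        simpa [b] using this
      refine ⟨op ((l : K) : G) • x, ⟨_, (l : K).2, l.2, rfl⟩, ?_⟩
      change op (o : G)⁻¹ • (op ((l : K) : G) • x) = op a • x
      rw [← act_mul, hoe]
      congr 2
      group
    exact (Set.finite_iUnion fun q => hfin.image _).subset hsub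
  let e := hinfL.natEmbedding
  have he : ∀ i : ℕ, ∃ a ∈ K, a ∈ L ∧ op a • x = (e i : ∀ i, Fin (d i)) := fun i => (e i).2
  choose σ h1 h2 h3 using he
  have hsep : ∀ p : Fin m × Fin m, ∃ N, p.1 ≠ p.2 → ∀ k ≥ N,
      Disjoint (cylinder d k (op (σ p.1) • x)) (cylinder d k (op (σ p.2) • x)) := by
    rintro ⟨i, j⟩
    by_cases hij : i = j
    · exact ⟨0, fun h => absurd hij h⟩
    · have : op (σ i) • x ≠ op (σ j) • x := by
        rw [h3, h3]
        intro h
        exact hij (Fin.ext (e.injective (Subtype.ext h)))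
      obtain ⟨N, hN⟩ := cyl_separate this
      exact ⟨N, fun _ => hN⟩
  choose f hf using hsep
  refine ⟨fun i => σ i, max n (Finset.univ.sup f), le_max_left _ _, fun i => h2 i, fun i => h1 i, ?_⟩
  intro i j hij
  exact hf (i, j) hij _ (le_max_of_le_right (Finset.le_sup (f := f) (Finset.mem_univ (i, j))))

end geometry

section deterministic

variable {G : Type*} [Group G] {d : ℕ → ℕ} [MulAction Gᵐᵒᵖ (∀ i, Fin (d i))]

theorem exists_core (L K : Subgroup G) (h : L.relIndex K ≠ 0) :
    ∃ Λ : Subgroup G, Λ ≤ L ∧ Λ.relIndex K ≠ 0 ∧ ∀ b ∈ K, ∀ s ∈ Λ, b * s * b⁻¹ ∈ Λ := by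
  have hfi : (L.subgroupOf K).FiniteIndex := ⟨h⟩
  refine ⟨((L.subgroupOf K).normalCore).map K.subtype, ?_, ?_, ?_⟩
  · rintro _ ⟨y, hy, rfl⟩
    have h5 : y ∈ L.subgroupOf K := Subgroup.normalCore_le (L.subgroupOf K) hy
    exact h5
  · have : (((L.subgroupOf K).normalCore).map K.subtype).subgroupOf K
        = (L.subgroupOf K).normalCore :=
      Subgroup.comap_map_eq_self_of_injective K.subtype_injective _
    unfold Subgroup.relIndex
    rw [this]
    exact Subgroup.FiniteIndex.index_ne_zero
  · rintro b hb _ ⟨y, hy, rfl⟩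
    exact ⟨⟨b, hb⟩ * y * ⟨b, hb⟩⁻¹,
      (Subgroup.normalCore_normal (L.subgroupOf K)).conj_mem y hy ⟨b, hb⟩, rfl⟩

theorem mem_normalizer_of_return
    (hfaith : ∀ g : G, (∀ x : ∀ i, Fin (d i), op g • x = x) → g = 1)
    {U U' : Set (∀ i, Fin (d i))} (hUU : Disjoint U U') {g : G}
    (hU : (fun x : ∀ i, Fin (d i) => op g • x) '' U = U')
    {H : Subgroup G} (hg : g ∈ H) {γ : G} (hγ : γ ∈ rigidStabilizer G U)
    (hr : γ⁻¹ * g * γ ∈ H) :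
    ∀ n, n ∈ H ⊓ rigidStabilizer G U ↔ γ * n * γ⁻¹ ∈ H ⊓ rigidStabilizer G U := by
  have hk : g⁻¹ * γ⁻¹ * g ∈ rigidStabilizer G U' := rist_conj hU (inv_mem hγ)
  have hh : g⁻¹ * γ⁻¹ * g * γ ∈ H := by
    have := H.mul_mem (H.inv_mem hg) hr
    simpa [mul_assoc] using this
  generalize g⁻¹ * γ⁻¹ * g = k at hk hh
  intro n
  constructor
  · rintro ⟨hn1, hn2⟩
    have h2 : γ * n * γ⁻¹ ∈ rigidStabilizer G U := mul_mem (mul_mem hγ hn2) (inv_mem hγ)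
    refine ⟨?_, h2⟩
    have h3 := H.mul_mem (H.mul_mem hh hn1) (H.inv_mem hh)
    have h4 := rist_comm hfaith hUU h2 hk
    have : k * γ * n * (k * γ)⁻¹ = γ * n * γ⁻¹ := by
      calc k * γ * n * (k * γ)⁻¹ = k * (γ * n * γ⁻¹) * k⁻¹ := by group
        _ = γ * n * γ⁻¹ := by rw [← h4]; group
    rw [← this]; exact h3
  · rintro ⟨hn1, hn2⟩
    have h2 : n ∈ rigidStabilizer G U := by
      have := mul_mem (mul_mem (inv_mem hγ) hn2) hγ
      simpa [mul_assoc] using this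
    refine ⟨?_, h2⟩
    have h3 := H.mul_mem (H.mul_mem (H.inv_mem hh) hn1) hh
    have h4 := rist_comm hfaith hUU hn2 hk
    have : (k * γ)⁻¹ * (γ * n * γ⁻¹) * (k * γ) = n := by
      calc (k * γ)⁻¹ * (γ * n * γ⁻¹) * (k * γ) = γ⁻¹ * k⁻¹ * ((γ * n * γ⁻¹) * k) * γ := by group
        _ = n := by rw [h4]; group
    rw [← this]; exact h3

theorem relIndex_ne_zero_of_pigeon (L K : Subgroup G) (m : ℕ)
    (h : ∀ γ : Fin m → G, (∀ i, γ i ∈ K) → ∃ i j, i ≠ j ∧ γ i * (γ j)⁻¹ ∈ L) :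
    L.relIndex K ≠ 0 := by
  intro h0
  have hinf : Infinite (K ⧸ L.subgroupOf K) := by
    rw [← not_finite_iff_infinite]
    intro hfin
    exact (Subgroup.finiteIndex_of_finite_quotient (H := L.subgroupOf K)).index_ne_zero h0
  let e := Infinite.natEmbedding (K ⧸ L.subgroupOf K)
  obtain ⟨i, j, hij, hL⟩ := h (fun i => ((Quotient.out (e i) : K) : G)⁻¹)
    (fun i => K.inv_mem (Subtype.prop _))
  apply hij
  apply Fin.ext
  apply e.injective
  rw [← QuotientGroup.out_eq' (e i), ← QuotientGroup.out_eq' (e j)]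
  rw [QuotientGroup.eq]
  rw [Subgroup.mem_subgroupOf]
  simpa using hL

theorem local_commutator
    (hfaith : ∀ g : G, (∀ x : ∀ i, Fin (d i), op g • x = x) → g = 1)
    (htree : ActsByTreeAutomorphisms G d) (htrans : LevelTransitive G d)
    (hwb : ∀ (ℓ : ℕ) (z : ∀ i, Fin (d i)), rigidStabilizer G (cylinder d ℓ z) ≠ ⊥)
    (n : ℕ) (x : ∀ i, Fin (d i)) (g : G) (H : Subgroup G) (hg : g ∈ H)
    (hdisj : Disjoint (cylinder d n x) (cylinder d n (op g • x)))
    (ν : Measure (Subgroup G)) [IsProbabilityMeasure ν]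
    (K : Subgroup G) (hK : K = rigidStabilizer G (cylinder d n x))
    (E : G → Set (Subgroup G)) (hE : ∀ γ, E γ = {H' | γ⁻¹ * g * γ ∈ H'})
    (hp : ν (E 1) ≠ 0) (h1 : ∀ γ ∈ K, ν (E γ) = ν (E 1))
    (h2 : ∀ γ ∈ K, ∀ δ ∈ K, ∀ τ ∈ K, ν (E (γ * τ) ∩ E (δ * τ)) = ν (E γ ∩ E δ))
    (h3 : ∀ γ₁ ∈ K, ∀ γ₂ ∈ K, ∀ γ₃ ∈ K, ∀ γ₄ ∈ K,
      ν ((E γ₁ ∩ E γ₂) ∩ (E γ₃ ∩ E γ₄)) ≠ 0 →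
      ∃ κ ∈ K, ((γ₁ * κ)⁻¹ * g * (γ₁ * κ) ∈ H ∧ (γ₂ * κ)⁻¹ * g * (γ₂ * κ) ∈ H) ∧
        ((γ₃ * κ)⁻¹ * g * (γ₃ * κ) ∈ H ∧ (γ₄ * κ)⁻¹ * g * (γ₄ * κ) ∈ H)) :
    ∃ k, ⁅rigidStabilizer G (cylinder d k x), rigidStabilizer G (cylinder d k x)⁆ ≤ H := by
  have himg := cyl_image htree g n x
  have hEm : ∀ γ, MeasurableSet (E γ) := fun γ => by rw [hE]; exact measurableSet_memSub _
  set N : Subgroup G := H ⊓ K with hN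
  -- the normalizer of `N`
  obtain ⟨L, hL⟩ : ∃ L : Subgroup G, ∀ γ, γ ∈ L ↔ ∀ n, n ∈ N ↔ γ * n * γ⁻¹ ∈ N :=
    ⟨Subgroup.normalizer (N : Set G), fun γ => Subgroup.mem_normalizer_iff⟩
  have hret : ∀ γ ∈ K, γ⁻¹ * g * γ ∈ H → γ ∈ L := by
    intro γ hγ hr
    rw [hL, hN, hK]
    rw [hK] at hγ
    exact mem_normalizer_of_return hfaith hdisj himg hg hγ hr
  obtain ⟨m, ε, hε, hpig⟩ := pigeon (ν (E 1)) hp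
  obtain ⟨M, ε', hε', hpig'⟩ := pigeon ε hε
  have hLK : L.relIndex K ≠ 0 := by
    apply relIndex_ne_zero_of_pigeon L K m
    intro γ hγ
    obtain ⟨i, j, hij, hle⟩ := hpig _ _ ν inferInstance (fun i => E (γ i)) (fun i => hEm _)
      (fun i => (h1 _ (hγ i)).ge)
    refine ⟨i, j, hij, ?_⟩
    have hne : ν ((E (γ i) ∩ E (γ j)) ∩ (E (γ i) ∩ E (γ j))) ≠ 0 := by
      rw [Set.inter_self]
      exact fun h => hε (le_antisymm (h ▸ hle) zero_le)
    obtain ⟨κ, hκ, ⟨ha, hb⟩, -⟩ := h3 _ (hγ i) _ (hγ j) _ (hγ i) _ (hγ j) hne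
    have h5 := L.mul_mem (hret _ (K.mul_mem (hγ i) hκ) ha)
      (L.inv_mem (hret _ (K.mul_mem (hγ j) hκ) hb))
    have : γ i * κ * (γ j * κ)⁻¹ = γ i * (γ j)⁻¹ := by group
    rwa [this] at h5
  obtain ⟨Λ, hΛL, hΛK, hΛn⟩ := exists_core L K hLK
  obtain ⟨σ, k1, hk1, hσΛ, hσK, hσd⟩ := many_translates hfaith htree htrans hwb n x Λ
    (hK ▸ hΛK) m
  rw [← hK] at hσK
  obtain ⟨ρ, k2, hk2, -, hρW, hρd⟩ := many_translates hfaith htree htrans hwb k1 x ⊤ (by simp) M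
  -- main step
  have hmain : ∀ a ∈ rigidStabilizer G (cylinder d k2 x), ∃ r : G,
      Disjoint (cylinder d k2 x) (cylinder d k2 (op r⁻¹ • x)) ∧ a * (r * a⁻¹ * r⁻¹) ∈ N := by
    intro a ha
    have haW := rist_mono (cyl_anti hk2 x) ha
    have hconjW : ∀ i, ∀ b ∈ rigidStabilizer G (cylinder d k1 x),
        (σ i)⁻¹ * b * σ i ∈ rigidStabilizer G (cylinder d k1 (op (σ i) • x)) := fun i b hb =>
      rist_conj (cyl_image htree (σ i) k1 x) hb
    have hWK : ∀ b ∈ rigidStabilizer G (cylinder d k1 x), b ∈ K := fun b hb => by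
      rw [hK]; exact rist_mono (cyl_anti hk1 x) hb
    have hconjK : ∀ i, ∀ b ∈ rigidStabilizer G (cylinder d k1 x), (σ i)⁻¹ * b * σ i ∈ K :=
      fun i b hb => K.mul_mem (K.mul_mem (K.inv_mem (hσK i)) (hWK b hb)) (hσK i)
    obtain ⟨i, j, hij, hle⟩ := hpig _ _ ν inferInstance (fun i => E ((σ i)⁻¹ * a * σ i))
      (fun i => hEm _) (fun i => (h1 _ (hconjK i a haW)).ge)
    obtain ⟨l, l', hll, hle'⟩ := hpig' _ _ ν inferInstance
      (fun l => E ((σ i)⁻¹ * a * σ i * ((σ i)⁻¹ * ρ l * σ i)) ∩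
        E ((σ j)⁻¹ * a * σ j * ((σ i)⁻¹ * ρ l * σ i)))
      (fun l => (hEm _).inter (hEm _))
      (fun l => by
        rw [h2 _ (hconjK i a haW) _ (hconjK j a haW) _ (hconjK i _ (hρW l))]
        exact hle)
    have hcAi := hconjW i a haW
    have hcAj := hconjW j a haW
    have hct := hconjW i _ (hρW l)
    have hct' := hconjW i _ (hρW l')
    have hKAi := hconjK i a haW
    have hKAj := hconjK j a haW
    have hKt := hconjK i _ (hρW l)
    have hKt' := hconjK i _ (hρW l')
    obtain ⟨κ, hκ, ⟨ha1, ha2⟩, ha3, ha4⟩ := h3 _ (K.mul_mem hKAi hKt) _ (K.mul_mem hKAj hKt)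
      _ (K.mul_mem hKAi hKt') _ (K.mul_mem hKAj hKt')
      (fun h => hε' (le_antisymm (h ▸ hle') zero_le))
    refine ⟨ρ l * (ρ l')⁻¹, ?_, ?_⟩
    · rw [mul_inv_rev, inv_inv, act_mul]
      have hd := hρd l l' hll
      rw [Set.disjoint_left] at hd ⊢
      intro y hy hy'
      refine hd (a := op (ρ l) • y) ?_ ?_
      · rw [← cyl_image htree]; exact ⟨y, hy, rfl⟩
      · have : op (ρ l) • y ∈ cylinder d k2 (op (ρ l) • (op (ρ l)⁻¹ • (op (ρ l') • x))) := by
          rw [← cyl_image htree]; exact ⟨y, hy', rfl⟩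
        rwa [act_act_inv] at this
    · have key : ∀ Ai Aj t t' : G, Ai ∈ K → Aj ∈ K → t ∈ K → t' ∈ K →
          Aj * Ai = Ai * Aj → Aj * t = t * Aj → Aj * t' = t' * Aj →
          (Ai * t * κ)⁻¹ * g * (Ai * t * κ) ∈ H → (Aj * t * κ)⁻¹ * g * (Aj * t * κ) ∈ H →
          (Ai * t' * κ)⁻¹ * g * (Ai * t' * κ) ∈ H → (Aj * t' * κ)⁻¹ * g * (Aj * t' * κ) ∈ H →
          t * t'⁻¹ * Ai * (t * t'⁻¹)⁻¹ * Ai⁻¹ ∈ N := by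
        intro Ai Aj t t' hAi hAj ht ht' _ cjt cjt' q1 q2 q3 q4
        have hP : g⁻¹ * (Ai * Aj⁻¹) * g ∈ rigidStabilizer G (cylinder d n (op g • x)) :=
          rist_conj himg (hK ▸ K.mul_mem hAi (K.inv_mem hAj))
        have hPc : ∀ c ∈ K, c * (g⁻¹ * (Ai * Aj⁻¹) * g) = g⁻¹ * (Ai * Aj⁻¹) * g * c :=
          fun c hc => rist_comm hfaith hdisj (hK ▸ hc) hP
        have k1' := K.mul_mem (K.mul_mem hAi ht) hκ
        have k2' := K.mul_mem (K.mul_mem hAj ht) hκ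
        have k3' := K.mul_mem (K.mul_mem hAi ht') hκ
        have k4' := K.mul_mem (K.mul_mem hAj ht') hκ
        have c1L := hret _ k1' q1
        have e1 : (Ai * t * κ)⁻¹ * (Aj * t * κ) * (g⁻¹ * (Ai * Aj⁻¹) * g) ∈ H := by
          rw [mul_assoc, hPc _ k2']
          have := H.mul_mem (H.inv_mem q1) q2
          convert this using 1
          group
        have e2 : (Ai * t' * κ)⁻¹ * (Aj * t' * κ) * (g⁻¹ * (Ai * Aj⁻¹) * g) ∈ H := by
          rw [mul_assoc, hPc _ k4']
          have := H.mul_mem (H.inv_mem q3) q4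
          convert this using 1
          group
        have e3 : (Ai * t * κ)⁻¹ * (Aj * t * κ) *
            ((Ai * t' * κ)⁻¹ * (Aj * t' * κ))⁻¹ ∈ N := by
          refine ⟨?_, K.mul_mem (K.mul_mem (K.inv_mem k1') k2')
            (K.inv_mem (K.mul_mem (K.inv_mem k3') k4'))⟩
          have := H.mul_mem e1 (H.inv_mem e2)
          change _ ∈ H
          convert this using 1
          group
        have e4 := ((hL _).1 c1L _).1 e3
        have e5 : Aj * (t * t'⁻¹) * Aj⁻¹ = t * t'⁻¹ := by
          have c2 : Aj * t'⁻¹ = t'⁻¹ * Aj := by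
            calc Aj * t'⁻¹ = t'⁻¹ * (t' * Aj) * t'⁻¹ := by group
              _ = t'⁻¹ * Aj := by rw [← cjt']; group
          calc Aj * (t * t'⁻¹) * Aj⁻¹ = (Aj * t) * t'⁻¹ * Aj⁻¹ := by group
            _ = t * (Aj * t'⁻¹) * Aj⁻¹ := by rw [cjt]; group
            _ = t * t'⁻¹ := by rw [c2]; group
        convert e4 using 1
        calc t * t'⁻¹ * Ai * (t * t'⁻¹)⁻¹ * Ai⁻¹
            = (Aj * (t * t'⁻¹) * Aj⁻¹) * Ai * (t * t'⁻¹)⁻¹ * Ai⁻¹ := by rw [e5]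
          _ = _ := by group
      have hy := key _ _ _ _ hKAi hKAj hKt hKt'
        (rist_comm hfaith (hσd j i hij.symm) hcAj hcAi)
        (rist_comm hfaith (hσd j i hij.symm) hcAj hct)
        (rist_comm hfaith (hσd j i hij.symm) hcAj hct') ha1 ha2 ha3 ha4
      have hy2 := N.inv_mem (((hL _).1 (hΛL (hσΛ i)) _).1 hy)
      have e : a * (ρ l * (ρ l')⁻¹ * a⁻¹ * (ρ l * (ρ l')⁻¹)⁻¹) =
        (σ i * ((σ i)⁻¹ * ρ l * σ i * ((σ i)⁻¹ * ρ l' * σ i)⁻¹ * ((σ i)⁻¹ * a * σ i) *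
          ((σ i)⁻¹ * ρ l * σ i * ((σ i)⁻¹ * ρ l' * σ i)⁻¹)⁻¹ *
            ((σ i)⁻¹ * a * σ i)⁻¹) * (σ i)⁻¹)⁻¹ := by group
      rw [e]
      exact hy2
  have hstep : ∀ a ∈ rigidStabilizer G (cylinder d k2 x),
      ∀ b ∈ rigidStabilizer G (cylinder d k2 x), b ∈ L → a * b * a⁻¹ * b⁻¹ ∈ H := by
    intro a ha b hb hbL
    obtain ⟨r, hr, hc⟩ := hmain a ha
    have ha' : r * a⁻¹ * r⁻¹ ∈ rigidStabilizer G (cylinder d k2 (op r⁻¹ • x)) := by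
      have := rist_conj (cyl_image htree r⁻¹ k2 x) (inv_mem ha)
      simpa using this
    have hcomm := rist_comm hfaith hr hb ha'
    generalize r * a⁻¹ * r⁻¹ = a' at hc ha' hcomm
    have h6 := N.mul_mem hc (((hL _).1 hbL _).1 (N.inv_mem hc))
    have e : a * a' * (b * (a * a')⁻¹ * b⁻¹) = a * b * a⁻¹ * b⁻¹ := by
      calc a * a' * (b * (a * a')⁻¹ * b⁻¹) = a * (a' * b) * a'⁻¹ * a⁻¹ * b⁻¹ := by group
        _ = _ := by rw [← hcomm]; group
    rw [e] at h6
    exact h6.1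
  have hVK : rigidStabilizer G (cylinder d k2 x) ≤ K := by
    rw [hK]; exact rist_mono (cyl_anti (hk1.trans hk2) x)
  obtain ⟨s, k3, hk3, hsΛ, hsV, hsd⟩ := many_translates hfaith htree htrans hwb k2 x Λ
    (mt (Subgroup.relIndex_eq_zero_of_le_right hVK) hΛK) 2
  refine ⟨k3, ?_⟩
  rw [Subgroup.commutator_le]
  intro a ha b hb
  rw [commutatorElement_def]
  have hs : s 0 * (s 1)⁻¹ ∈ Λ := Λ.mul_mem (hsΛ 0) (Λ.inv_mem (hsΛ 1))
  have hs' : s 0 * (s 1)⁻¹ ∈ rigidStabilizer G (cylinder d k2 x) :=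
    mul_mem (hsV 0) (inv_mem (hsV 1))
  have hdis : Disjoint (cylinder d k3 x) (cylinder d k3 (op (s 0 * (s 1)⁻¹) • x)) := by
    have hd := hsd 1 0 (by decide)
    rw [Set.disjoint_left] at hd ⊢
    intro y hy hy'
    refine hd (a := op (s 1) • y) ?_ ?_
    · rw [← cyl_image htree]; exact ⟨y, hy, rfl⟩
    · have : op (s 1) • y ∈ cylinder d k3 (op (s 1) • (op (s 0 * (s 1)⁻¹) • x)) := by
        rw [← cyl_image htree]; exact ⟨y, hy', rfl⟩
      rwa [← act_mul, inv_mul_cancel_right] at this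
  generalize s 0 * (s 1)⁻¹ = t at hs hs' hdis
  have hb' : t⁻¹ * b⁻¹ * t ∈ rigidStabilizer G (cylinder d k3 (op t • x)) :=
    rist_conj (cyl_image htree t k3 x) (inv_mem hb)
  have hcomm := rist_comm hfaith hdis ha hb'
  have haV := rist_mono (cyl_anti hk3 x) ha
  have hbV := rist_mono (cyl_anti hk3 x) hb
  have hbb : b * (t⁻¹ * b⁻¹ * t) ∈ L := by
    apply hΛL
    have := Λ.mul_mem (hΛn b (hVK hbV) _ (Λ.inv_mem hs)) hs
    simpa [mul_assoc] using this
  have h7 := hstep a haV (b * (t⁻¹ * b⁻¹ * t))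
    (mul_mem hbV (mul_mem (mul_mem (inv_mem hs') (inv_mem hbV)) hs')) hbb
  generalize t⁻¹ * b⁻¹ * t = b' at h7 hcomm
  have e : a * (b * b') * a⁻¹ * (b * b')⁻¹ = a * b * a⁻¹ * b⁻¹ := by
    have hc2 : b' * a⁻¹ = a⁻¹ * b' := by
      calc b' * a⁻¹ = a⁻¹ * (a * b') * a⁻¹ := by group
        _ = a⁻¹ * b' := by rw [hcomm]; group
    calc a * (b * b') * a⁻¹ * (b * b')⁻¹ = a * b * (b' * a⁻¹) * b'⁻¹ * b⁻¹ := by group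
      _ = _ := by rw [hc2]; group
  rwa [e] at h7

end deterministic

section assembly

open scoped commutatorElement

variable {G : Type*} [Group G] {d : ℕ → ℕ} [MulAction Gᵐᵒᵖ (∀ i, Fin (d i))]

theorem finite_cylinders (n : ℕ) : (Set.range (cylinder d n)).Finite := by
  let e : (∀ i : Fin n, Fin (d i)) → Set (∀ i, Fin (d i)) :=
    fun w => {x | ∀ i : Fin n, x i = w i}
  refine (Set.finite_range e).subset ?_
  rintro _ ⟨z, rfl⟩
  refine ⟨fun i => z i, ?_⟩
  ext x
  exact ⟨fun h i hi => h ⟨i, hi⟩, fun h i => h i i.2⟩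

theorem ae_local_set [Countable G]
    (hfaith : ∀ g : G, (∀ x : ∀ i, Fin (d i), op g • x = x) → g = 1)
    (htree : ActsByTreeAutomorphisms G d) (htrans : LevelTransitive G d)
    (hwb : ∀ (ℓ : ℕ) (z : ∀ i, Fin (d i)), rigidStabilizer G (cylinder d ℓ z) ≠ ⊥)
    (μ : Measure (Subgroup G)) [IsProbabilityMeasure μ]
    (hinv : ∀ g : G, ∀ A : Set (Subgroup G), MeasurableSet A →
      μ ((fun H : Subgroup G => conjSubgroup g H) ⁻¹' A) = μ A)
    (g : G) (n : ℕ) (U : Set (∀ i, Fin (d i))) :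
    ∀ᵐ H ∂μ, g ∈ H → ∀ x, cylinder d n x = U →
      Disjoint (cylinder d n x) (cylinder d n (op g • x)) →
      ∃ k, ⁅rigidStabilizer G (cylinder d k x), rigidStabilizer G (cylinder d k x)⁆ ≤ H := by
  set K := rigidStabilizer G U with hK
  let E : G → Set (Subgroup G) := fun γ => {H' | γ⁻¹ * g * γ ∈ H'}
  have hEm : ∀ γ, MeasurableSet (E γ) := fun γ => measurableSet_memSub _
  let B : G × G × G × G → Set (Subgroup G) :=
    fun p => (E p.1 ∩ E p.2.1) ∩ (E p.2.2.1 ∩ E p.2.2.2)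
  have hpre : ∀ k γ (H : Subgroup G), conjSubgroup k H ∈ E γ ↔ H ∈ E (γ * k⁻¹) := by
    intro k γ H
    change γ⁻¹ * g * γ ∈ conjSubgroup k H ↔ (γ * k⁻¹)⁻¹ * g * (γ * k⁻¹) ∈ H
    rw [mem_conjSubgroup]
    have : k * (γ⁻¹ * g * γ) * k⁻¹ = (γ * k⁻¹)⁻¹ * g * (γ * k⁻¹) := by group
    rw [this]
  have hpreB : ∀ k p, (fun H : Subgroup G => conjSubgroup k H) ⁻¹' B p =
      B (p.1 * k⁻¹, p.2.1 * k⁻¹, p.2.2.1 * k⁻¹, p.2.2.2 * k⁻¹) := by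
    intro k p
    ext H
    simp only [B, Set.mem_preimage, Set.mem_inter_iff, hpre]
  filter_upwards [exists_local_measure μ hinv K B
    (fun p => ((hEm _).inter (hEm _)).inter ((hEm _).inter (hEm _)))] with H hH hg x hx hdisj
  obtain ⟨ν, hν, hν1, hν2, hν3⟩ := hH
  have hEB : ∀ γ, E γ = B (γ, γ, γ, γ) := fun γ => by simp [B]
  have hEB2 : ∀ γ δ, E γ ∩ E δ = B (γ, δ, γ, δ) := fun γ δ => by simp [B]
  have hmul : ∀ p, ∀ k ∈ K, ν (B (p.1 * k, p.2.1 * k, p.2.2.1 * k, p.2.2.2 * k)) = ν (B p) := by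
    intro p k hk
    have := hν1 p k⁻¹ (K.inv_mem hk)
    rw [hpreB, inv_inv] at this
    exact this
  refine local_commutator hfaith htree htrans hwb n x g H hg hdisj ν K (by rw [hK, hx]) E
    (fun _ => rfl) ?_ ?_ ?_ ?_
  · rw [hEB]
    apply hν3
    rw [← hEB]
    change (1 : G)⁻¹ * g * 1 ∈ H
    simpa using hg
  · intro γ hγ
    rw [hEB, hEB, ← hmul (1, 1, 1, 1) γ hγ]
    simp
  · intro γ _ δ _ τ hτ
    rw [hEB2, hEB2, ← hmul (γ, δ, γ, δ) τ hτ]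
  · intro γ₁ _ γ₂ _ γ₃ _ γ₄ _ hne
    obtain ⟨k, hk, hkB⟩ := hν2 (γ₁, γ₂, γ₃, γ₄) hne
    have : H ∈ (fun H : Subgroup G => conjSubgroup k H) ⁻¹' B (γ₁, γ₂, γ₃, γ₄) := hkB
    rw [hpreB] at this
    exact ⟨k⁻¹, K.inv_mem hk, this⟩

theorem ae_local [Countable G]
    (hfaith : ∀ g : G, (∀ x : ∀ i, Fin (d i), op g • x = x) → g = 1)
    (htree : ActsByTreeAutomorphisms G d) (htrans : LevelTransitive G d)
    (hwb : ∀ (ℓ : ℕ) (z : ∀ i, Fin (d i)), rigidStabilizer G (cylinder d ℓ z) ≠ ⊥)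
    (μ : Measure (Subgroup G)) [IsProbabilityMeasure μ]
    (hinv : ∀ g : G, ∀ A : Set (Subgroup G), MeasurableSet A →
      μ ((fun H : Subgroup G => conjSubgroup g H) ⁻¹' A) = μ A) :
    ∀ᵐ H ∂μ, ∀ x, x ∉ fixedSet (∀ i, Fin (d i)) H →
      ∃ k, ⁅rigidStabilizer G (cylinder d k x), rigidStabilizer G (cylinder d k x)⁆ ≤ H := by
  have h : ∀ᵐ H ∂μ, ∀ (g : G) (n : ℕ), ∀ U ∈ Set.range (cylinder d n),
      g ∈ H → ∀ x, cylinder d n x = U →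
      Disjoint (cylinder d n x) (cylinder d n (op g • x)) →
      ∃ k, ⁅rigidStabilizer G (cylinder d k x), rigidStabilizer G (cylinder d k x)⁆ ≤ H := by
    rw [ae_all_iff]
    intro g
    rw [ae_all_iff]
    intro n
    rw [ae_ball_iff (finite_cylinders n).countable]
    intro U _
    exact ae_local_set hfaith htree htrans hwb μ hinv g n U
  filter_upwards [h] with H hH x hx
  simp only [fixedSet, Set.mem_ofPred_eq, not_forall] at hx
  obtain ⟨g, hg, hgx⟩ := hx
  obtain ⟨n, hn⟩ := cyl_separate (Ne.symm hgx)
  exact hH g n _ ⟨x, rfl⟩ hg x rfl (hn n le_rfl)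

theorem isOpen_cylinder (n : ℕ) (z : ∀ i, Fin (d i)) : IsOpen (cylinder d n z) := by
  have : cylinder d n z = ⋂ i ∈ Finset.range n, {x | x i = z i} := by
    ext x; simp [_root_.cylinder]
  rw [this]
  refine isOpen_biInter_finset fun i _ => ?_
  have hc : Continuous (fun x : ∀ i, Fin (d i) => x i) := continuous_apply i
  exact (isOpen_discrete ({z i} : Set (Fin (d i)))).preimage hc

theorem isClosed_cylinder (n : ℕ) (z : ∀ i, Fin (d i)) : IsClosed (cylinder d n z) := by
  have : cylinder d n z = ⋂ i ∈ Finset.range n, {x | x i = z i} := by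
    ext x; simp [_root_.cylinder]
  rw [this]
  refine isClosed_biInter fun i _ => ?_
  have hc : Continuous (fun x : ∀ i, Fin (d i) => x i) := continuous_apply i
  exact (isClosed_discrete ({z i} : Set (Fin (d i)))).preimage hc

theorem commutator_iSup_le {ι : Type*} (R : ι → Subgroup G) (H : Subgroup G)
    (hH : ∀ i, ⁅R i, R i⁆ ≤ H)
    (hc : ∀ i j, R i = R j ∨ ∀ a ∈ R i, ∀ b ∈ R j, a * b = b * a) :
    ⁅⨆ i, R i, ⨆ i, R i⁆ ≤ H := by
  set D : Subgroup G := ⨆ i, ⁅R i, R i⁆ with hD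
  have hDi : ∀ i, ⁅R i, R i⁆ ≤ D := fun i => le_iSup (fun i => ⁅R i, R i⁆) i
  refine le_trans ?_ (iSup_le hH : D ≤ H)
  have hnorm : ∀ x ∈ ⨆ i, R i, ∀ y ∈ D, x * y * x⁻¹ ∈ D := by
    suffices h : (⨆ i, R i) ≤ Subgroup.normalizer (D : Set G) from fun x hx y hy =>
      (Subgroup.mem_normalizer_iff.1 (h hx) y).1 hy
    refine iSup_le fun i => ?_
    have hconj : ∀ x ∈ R i, ∀ y ∈ D, x * y * x⁻¹ ∈ D := by
      intro x hx
      suffices h : D ≤ D.comap (MulAut.conj x).toMonoidHom from fun y hy => h hy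
      refine iSup_le fun j => ?_
      rw [Subgroup.commutator_le]
      intro a ha b hb
      change x * ⁅a, b⁆ * x⁻¹ ∈ D
      rcases hc i j with hij | hij
      · rw [hij] at hx
        apply hDi j
        rw [show x * ⁅a, b⁆ * x⁻¹ = ⁅x * a * x⁻¹, x * b * x⁻¹⁆ by
          simp only [commutatorElement_def]; group]
        exact Subgroup.commutator_mem_commutator
          (mul_mem (mul_mem hx ha) (inv_mem hx)) (mul_mem (mul_mem hx hb) (inv_mem hx))
      · have h1 : ⁅a, b⁆ ∈ R j := by
          rw [commutatorElement_def]
          exact mul_mem (mul_mem (mul_mem ha hb) (inv_mem ha)) (inv_mem hb)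
        rw [hij x hx _ h1, mul_inv_cancel_right]
        exact hDi j (Subgroup.commutator_mem_commutator ha hb)
    intro x hx
    rw [Subgroup.mem_normalizer_iff]
    intro y
    refine ⟨hconj x hx y, fun h => ?_⟩
    have := hconj x⁻¹ (inv_mem hx) _ h
    simpa [mul_assoc] using this
  have hgen : ∀ (P : Subgroup G) (q : G), P ≤ (⨆ i, R i) → q ∈ (⨆ i, R i) →
      ∀ a b, a ∈ P → b ∈ P → ⁅a, q⁆ ∈ D → ⁅b, q⁆ ∈ D → ⁅a * b, q⁆ ∈ D := by
    intro P q hP _ a b ha _ h1 h2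
    rw [show ⁅a * b, q⁆ = a * ⁅b, q⁆ * a⁻¹ * ⁅a, q⁆ by
      simp only [commutatorElement_def]; group]
    exact mul_mem (hnorm a (hP ha) _ h2) h1
  have hsymm : ∀ a b : G, ⁅a, b⁆ ∈ D → ⁅b, a⁆ ∈ D := by
    intro a b h
    rw [← commutatorElement_inv]; exact inv_mem h
  have hext : ∀ q ∈ (⨆ i, R i), (∀ i, ∀ a ∈ R i, ⁅a, q⁆ ∈ D) →
      ∀ a ∈ (⨆ i, R i), ⁅a, q⁆ ∈ D := by
    intro q hq h a ha
    have : ∀ x (hx : x ∈ ⨆ i, R i), ⁅x, q⁆ ∈ D := by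
      intro x hx
      induction hx using Subgroup.iSup_induction' with
      | hp i x hx => exact h i x hx
      | h1 => simp
      | hmul x y hx hy h1 h2 => exact hgen _ q le_rfl hq x y hx hy h1 h2
    exact this a ha
  have hbase : ∀ i, ∀ a ∈ R i, ∀ j, ∀ b ∈ R j, ⁅a, b⁆ ∈ D := by
    intro i a ha j b hb
    rcases hc i j with hij | hij
    · rw [hij] at ha
      exact hDi j (Subgroup.commutator_mem_commutator ha hb)
    · rw [commutatorElement_eq_one_iff_mul_comm.2 (hij a ha b hb)]
      exact one_mem _
  have hsub : ∀ i, R i ≤ ⨆ i, R i := le_iSup R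
  rw [Subgroup.commutator_le]
  intro a ha b hb
  refine hext b hb (fun i x hx => hsymm _ _ ?_) a ha
  exact hext x (hsub i hx) (fun j y hy => hbase j y hy i x hx) b hb

theorem ristLevel_commutator_le
    (hfaith : ∀ g : G, (∀ x : ∀ i, Fin (d i), op g • x = x) → g = 1)
    (H : Subgroup G) (ℓ : ℕ) (z : ∀ i, Fin (d i))
    (h : ∀ x ∈ cylinder d ℓ z,
      ∃ k, ⁅rigidStabilizer G (cylinder d k x), rigidStabilizer G (cylinder d k x)⁆ ≤ H) :
    ∃ m, ⁅ristLevel G d ℓ m z, ristLevel G d ℓ m z⁆ ≤ H := by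
  choose! k hk using h
  have hcomp : IsCompact (cylinder d ℓ z) := (isClosed_cylinder ℓ z).isCompact
  obtain ⟨t, htz, ht⟩ := hcomp.elim_nhds_subcover (fun x => cylinder d (k x) x)
    (fun x _ => (isOpen_cylinder (k x) x).mem_nhds (mem_cyl_self _ _))
  refine ⟨t.sup k, ?_⟩
  unfold ristLevel
  rw [iSup_subtype']
  apply commutator_iSup_le
  · rintro ⟨w, hw⟩
    obtain ⟨x, hx, hwx⟩ := Set.mem_iUnion₂.1 (ht hw)
    have hsub : cylinder d (ℓ + t.sup k) w ⊆ cylinder d (k x) x := by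
      rw [← cyl_eq_of_mem hwx]
      exact cyl_anti ((Finset.le_sup hx).trans (Nat.le_add_left _ _)) w
    exact (Subgroup.commutator_mono (rist_mono hsub) (rist_mono hsub)).trans (hk x (htz x hx))
  · rintro ⟨w, hw⟩ ⟨w', hw'⟩
    by_cases he : cylinder d (ℓ + t.sup k) w = cylinder d (ℓ + t.sup k) w'
    · left; simp only [he]
    · right
      intro a ha b hb
      exact rist_comm hfaith (cyl_disjoint he) ha hb

theorem ristLevel_anti (ℓ : ℕ) {m m' : ℕ} (h : m ≤ m') (z : ∀ i, Fin (d i)) :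
    ristLevel G d ℓ m' z ≤ ristLevel G d ℓ m z :=
  iSup₂_mono fun w _ => rist_mono (cyl_anti (Nat.add_le_add_left h ℓ) w)

theorem ristLevel_congr (ℓ m : ℕ) {z z' : ∀ i, Fin (d i)} (h : cylinder d ℓ z = cylinder d ℓ z') :
    ristLevel G d ℓ m z = ristLevel G d ℓ m z' := by
  unfold ristLevel; rw [h]

theorem ristLevel_conj (htree : ActsByTreeAutomorphisms G d) (g : G) (ℓ m : ℕ)
    (z : ∀ i, Fin (d i)) {a : G} (ha : a ∈ ristLevel G d ℓ m z) :
    g⁻¹ * a * g ∈ ristLevel G d ℓ m (op g • z) := by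
  suffices h : ristLevel G d ℓ m z ≤
      (ristLevel G d ℓ m (op g • z)).comap (MulAut.conj g⁻¹).toMonoidHom by
    have := h ha
    simpa using this
  refine iSup₂_le fun w hw => ?_
  intro a ha
  have h1 := rist_conj (cyl_image htree g (ℓ + m) w) ha
  have h2 : op g • w ∈ cylinder d ℓ (op g • z) := by
    rw [← cyl_image htree]; exact ⟨w, hw, rfl⟩
  have h3 : g⁻¹ * a * g ∈ ristLevel G d ℓ m (op g • z) :=
    (le_iSup₂_of_le (f := fun z' (_ : z' ∈ cylinder d ℓ (op g • z)) =>
      rigidStabilizer G (cylinder d (ℓ + m) z')) (op g • w) h2 le_rfl) h1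
  simpa using h3

theorem comm_conj_iff (htree : ActsByTreeAutomorphisms G d) (g : G) (ℓ m : ℕ)
    (z : ∀ i, Fin (d i)) (H : Subgroup G)
    (h : ⁅ristLevel G d ℓ m (op g⁻¹ • z), ristLevel G d ℓ m (op g⁻¹ • z)⁆ ≤ H) :
    ⁅ristLevel G d ℓ m z, ristLevel G d ℓ m z⁆ ≤ conjSubgroup g H := by
  rw [Subgroup.commutator_le] at h ⊢
  intro a ha b hb
  rw [mem_conjSubgroup]
  have := h _ (ristLevel_conj htree g⁻¹ ℓ m z ha) _ (ristLevel_conj htree g⁻¹ ℓ m z hb)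
  rw [show g * ⁅a, b⁆ * g⁻¹ = ⁅g⁻¹⁻¹ * a * g⁻¹, g⁻¹⁻¹ * b * g⁻¹⁆ by
          simp only [commutatorElement_def]; group]
  exact this

theorem comm_conj_iff' (htree : ActsByTreeAutomorphisms G d) (g : G) (ℓ m : ℕ)
    (z : ∀ i, Fin (d i)) (H : Subgroup G) :
    ⁅ristLevel G d ℓ m z, ristLevel G d ℓ m z⁆ ≤ conjSubgroup g H ↔
    ⁅ristLevel G d ℓ m (op g⁻¹ • z), ristLevel G d ℓ m (op g⁻¹ • z)⁆ ≤ H := by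
  refine ⟨fun h => ?_, comm_conj_iff htree g ℓ m z H⟩
  have h1 := comm_conj_iff htree g⁻¹ ℓ m (op g⁻¹ • z) (conjSubgroup g H)
    (by rwa [inv_inv, act_act_inv])
  rwa [conjSubgroup_conjSubgroup, mul_inv_cancel, conjSubgroup_one] at h1

theorem measurableSet_ge_sub [Countable G] (P : Subgroup G) :
    MeasurableSet {H : Subgroup G | P ≤ H} := by
  have : {H : Subgroup G | P ≤ H} = ⋂ γ ∈ (P : Set G), {H | γ ∈ H} := by
    ext H; simp [SetLike.le_def]
  rw [this]
  exact MeasurableSet.biInter (Set.to_countable _) fun γ _ => measurableSet_memSub γ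

/-- The uniformity event. -/
def unifSet (G : Type*) (d : ℕ → ℕ) [Group G] [MulAction Gᵐᵒᵖ (∀ i, Fin (d i))]
    (ℓ m : ℕ) : Set (Subgroup G) :=
  {H | ∀ z, (∃ m', ⁅ristLevel G d ℓ m' z, ristLevel G d ℓ m' z⁆ ≤ H) →
    ⁅ristLevel G d ℓ m z, ristLevel G d ℓ m z⁆ ≤ H}

theorem unifSet_mono (ℓ : ℕ) {m m' : ℕ} (h : m ≤ m') : unifSet G d ℓ m ⊆ unifSet G d ℓ m' :=
  fun _ hH z hz => (Subgroup.commutator_mono (ristLevel_anti ℓ h z)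
    (ristLevel_anti ℓ h z)).trans (hH z hz)

theorem unifSet_invariant (htree : ActsByTreeAutomorphisms G d) (ℓ m : ℕ) (g : G) :
    (fun H : Subgroup G => conjSubgroup g H) ⁻¹' unifSet G d ℓ m = unifSet G d ℓ m := by
  ext H
  simp only [unifSet, Set.mem_preimage, Set.mem_ofPred_eq, comm_conj_iff' htree]
  refine ⟨fun h z hz => ?_, fun h z hz => h _ hz⟩
  have := h (op g • z)
  rw [act_inv_act] at this
  exact this hz

theorem exists_reps (ℓ : ℕ) : ∃ S : Set (∀ i, Fin (d i)), S.Finite ∧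
    ∀ z, ∃ s ∈ S, cylinder d ℓ z = cylinder d ℓ s := by
  have hfin := finite_cylinders (d := d) ℓ
  obtain ⟨S, -, hS⟩ := Set.exists_subset_bijOn Set.univ (cylinder d ℓ)
  rw [Set.image_univ] at hS
  refine ⟨S, Set.Finite.of_finite_image (by rwa [hS.image_eq]) hS.injOn, fun z => ?_⟩
  obtain ⟨s, hs, he⟩ := hS.surjOn ⟨z, rfl⟩
  exact ⟨s, hs, he.symm⟩

theorem measurableSet_unifSet [Countable G] (ℓ m : ℕ) : MeasurableSet (unifSet G d ℓ m) := by
  obtain ⟨S, hSf, hS⟩ := exists_reps (d := d) ℓ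
  have : unifSet G d ℓ m = ⋂ z ∈ S,
      ((⋃ m', {H : Subgroup G | ⁅ristLevel G d ℓ m' z, ristLevel G d ℓ m' z⁆ ≤ H})ᶜ ∪
        {H | ⁅ristLevel G d ℓ m z, ristLevel G d ℓ m z⁆ ≤ H}) := by
    ext H
    simp only [Set.mem_iInter, Set.mem_union, Set.mem_compl_iff, Set.mem_iUnion,
      Set.mem_ofPred_eq, ← imp_iff_not_or]
    refine ⟨fun h z _ hz => h z hz, fun h z hz => ?_⟩
    obtain ⟨s, hs, he⟩ := hS z
    rw [ristLevel_congr ℓ m he]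
    refine h s hs ?_
    obtain ⟨m', hm'⟩ := hz
    exact ⟨m', by rwa [← ristLevel_congr ℓ m' he]⟩
  rw [this]
  exact MeasurableSet.biInter hSf.countable fun z _ =>
    (MeasurableSet.iUnion fun m' => measurableSet_ge_sub _).compl.union (measurableSet_ge_sub _)

theorem iUnion_unifSet (ℓ : ℕ) : ⋃ m, unifSet G d ℓ m = Set.univ := by
  obtain ⟨S, hSf, hS⟩ := exists_reps (d := d) ℓ
  refine Set.eq_univ_of_forall fun H => Set.mem_iUnion.2 ?_
  classical
  let f : (∀ i, Fin (d i)) → ℕ := fun z =>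
    if h : ∃ m', ⁅ristLevel G d ℓ m' z, ristLevel G d ℓ m' z⁆ ≤ H then h.choose else 0
  refine ⟨hSf.toFinset.sup f, fun z hz => ?_⟩
  obtain ⟨s, hs, he⟩ := hS z
  rw [ristLevel_congr ℓ _ he]
  have hz' : ∃ m', ⁅ristLevel G d ℓ m' s, ristLevel G d ℓ m' s⁆ ≤ H := by
    obtain ⟨m', hm'⟩ := hz
    exact ⟨m', by rwa [← ristLevel_congr ℓ m' he]⟩
  have hf : f s = hz'.choose := dif_pos hz'
  have hle : hz'.choose ≤ hSf.toFinset.sup f := by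
    rw [← hf]; exact Finset.le_sup (hSf.mem_toFinset.2 hs)
  exact (Subgroup.commutator_mono (ristLevel_anti ℓ hle s) (ristLevel_anti ℓ hle s)).trans
    hz'.choose_spec

theorem exists_unif [Countable G] (htree : ActsByTreeAutomorphisms G d)
    (μ : Measure (Subgroup G)) [IsProbabilityMeasure μ]
    (herg : ∀ A : Set (Subgroup G), MeasurableSet A →
      (∀ g : G, (fun H : Subgroup G => conjSubgroup g H) ⁻¹' A = A) → μ A = 0 ∨ μ A = 1)
    (ℓ : ℕ) : ∃ m, 0 < m ∧ ∀ᵐ H ∂μ, H ∈ unifSet G d ℓ m := by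
  obtain ⟨m, hm⟩ : ∃ m, μ (unifSet G d ℓ m) ≠ 0 := by
    by_contra! h
    have := measure_iUnion_null h
    rw [iUnion_unifSet, measure_univ] at this
    exact one_ne_zero this
  have h1 := (herg _ (measurableSet_unifSet ℓ m) (unifSet_invariant htree ℓ m)).resolve_left hm
  refine ⟨m + 1, Nat.succ_pos m, ?_⟩
  have h2 : ∀ᵐ H ∂μ, H ∈ unifSet G d ℓ m :=
    (mem_ae_iff_prob_eq_one (measurableSet_unifSet ℓ m)).2 h1
  filter_upwards [h2] with H hH
  exact unifSet_mono ℓ (Nat.le_succ m) hH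

end assembly

/-- **Corollary 1.4.** Let `Γ` be a countable weakly branch group acting on the boundary
`∏ i, Fin (d i)` of the spherically symmetric rooted tree with valency sequence `d`
(the right action is encoded as a left action of `Γᵐᵒᵖ`, so `x·g = op g • x`; a word of
length `ℓ` is represented by a boundary point `z` extending it, with cylinder
`cylinder d ℓ z`), and let `μ` be an ergodic IRS of `Γ`.  Then there are positive
integers `(m ℓ)` such that for `μ`-a.e. `H`: for every word `x` of length `ℓ` whose
cylinder is disjoint from `Fix(H)` and which is maximal with this property (i.e. `ℓ = 0`
or the cylinder of its length-`(ℓ-1)` prefix meets `Fix(H)`), one has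
`[Rist_{m ℓ}(T_x), Rist_{m ℓ}(T_x)] ≤ H`. -/
theorem weakly_branch_irs_contains_rist_commutators
    {G : Type*} [Group G] [Countable G] (d : ℕ → ℕ) (hd : ∀ i, 2 ≤ d i)
    [MulAction Gᵐᵒᵖ (∀ i, Fin (d i))]
    (hcont : ∀ g : G, Continuous fun x : ∀ i, Fin (d i) => op g • x)
    (hfaith : ∀ g : G, (∀ x : ∀ i, Fin (d i), op g • x = x) → g = 1)
    (htree : ActsByTreeAutomorphisms G d)
    (htrans : LevelTransitive G d)
    (hwb : ∀ (ℓ : ℕ) (z : ∀ i, Fin (d i)), rigidStabilizer G (cylinder d ℓ z) ≠ ⊥)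
    (μ : Measure (Subgroup G)) [IsProbabilityMeasure μ]
    (hinv : ∀ g : G, ∀ A : Set (Subgroup G), MeasurableSet A →
      μ ((fun H : Subgroup G => conjSubgroup g H) ⁻¹' A) = μ A)
    (herg : ∀ A : Set (Subgroup G), MeasurableSet A →
      (∀ g : G, (fun H : Subgroup G => conjSubgroup g H) ⁻¹' A = A) → μ A = 0 ∨ μ A = 1) :
    ∃ m : ℕ → ℕ, (∀ ℓ, 0 < m ℓ) ∧
      ∀ᵐ H ∂μ, ∀ (ℓ : ℕ) (z : ∀ i, Fin (d i)),
        cylinder d ℓ z ∩ fixedSet (∀ i, Fin (d i)) H = ∅ →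
        (ℓ = 0 ∨ (cylinder d (ℓ - 1) z ∩ fixedSet (∀ i, Fin (d i)) H).Nonempty) →
        ⁅ristLevel G d ℓ (m ℓ) z, ristLevel G d ℓ (m ℓ) z⁆ ≤ H := by
  choose m hm0 hm using exists_unif htree μ herg
  refine ⟨m, hm0, ?_⟩
  filter_upwards [ae_all_iff.2 hm, ae_local hfaith htree htrans hwb μ hinv] with H h1 h2 ℓ z hz _
  refine h1 ℓ z (ristLevel_commutator_le hfaith H ℓ z fun x hx => h2 x fun hxf => ?_)
  have : x ∈ cylinder d ℓ z ∩ fixedSet (∀ i, Fin (d i)) H := ⟨hx, hxf⟩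
  rw [hz] at this
  exact this
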